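/- Let m and n be positive integers with m odd, let A and B be m×n matrices and X an n×n matrix over a commutative ring, and let J denote the n×n all-ones matrix. Then det(A·X·Bᵗ + B·(J − Xᵗ)·Aᵗ) = g_{A,B}(X) · g_{B,A}(J − Xᵗ) = (−1)^{(m−1)/2} · g_{A,B}(X) · g_{B,A}(Xᵗ). -/

import Mathlib

open Matrix

/-- Strictly increasing functions `Fin k → Fin n`; these encode the `k`-element
subsets of `{1,…,n}` listed in increasing order. -/
def incrFuns (k n : ℕ) : Finset (Fin k → Fin n) :=
  Finset.univ.filter fun f => ∀ a b : Fin k, a < b → f a < f b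

/-- For odd `m = 2k+1`: the `m × m` matrix `(Aᴵ Bᴶ)` obtained by concatenating the
`k+1` columns of `A` indexed by `fI` with the `k` columns of `B` indexed by `fJ`. -/
def concatCBodd {R : Type*} [CommRing R] {k n : ℕ} (A B : Matrix (Fin (2*k+1)) (Fin n) R)
    (fI : Fin (k+1) → Fin n) (fJ : Fin k → Fin n) :
    Matrix (Fin (2*k+1)) (Fin (2*k+1)) R :=
  Matrix.of fun i j =>
    if h : (j:ℕ) < k+1 then A i (fI ⟨j, h⟩)
    else B i (fJ ⟨(j:ℕ) - (k+1), by have := j.isLt; omega⟩)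

/-- The `(k+1) × (k+1)` matrix `(𝟏 X_{I,J})` obtained by prepending an all-ones column
to the submatrix of `X` with rows indexed by `fI` and columns indexed by `fJ`. -/
def oneCol {R : Type*} [CommRing R] {k n : ℕ} (X : Matrix (Fin n) (Fin n) R)
    (fI : Fin (k+1) → Fin n) (fJ : Fin k → Fin n) :
    Matrix (Fin (k+1)) (Fin (k+1)) R :=
  Matrix.of fun i j =>
    if h : (j:ℕ) = 0 then 1 else X (fI i) (fJ ⟨(j:ℕ) - 1, by have := j.isLt; omega⟩)

/-- `g_{A,B}(X) = Σ_{I,J⊆[n], |I|=(m+1)/2, |J|=(m-1)/2} det(𝟏 X_{I,J}) · det(Aᴵ Bᴶ)`. -/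
def gAB {R : Type*} [CommRing R] {k n : ℕ} (A B : Matrix (Fin (2*k+1)) (Fin n) R)
    (X : Matrix (Fin n) (Fin n) R) : R :=
  ∑ fI ∈ incrFuns (k+1) n, ∑ fJ ∈ incrFuns k n,
    (oneCol X fI fJ).det * (concatCBodd A B fI fJ).det

/-- The all-ones matrix `𝒥`. -/
def allOnes (R : Type*) [CommRing R] (n : ℕ) : Matrix (Fin n) (Fin n) R :=
  Matrix.of fun _ _ => 1


section helpers

theorem aux_normal {K ι : Type*} [Field K] [Fintype ι] [DecidableEq ι] (k : ℕ) :
    ∀ (S : ι → ι → K) (s : Finset ι), (∀ p q, S p q = - S q p) → (∀ p, S p p = 0) →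
      (∀ p q, p ∉ s → S p q = 0) → s.card ≤ 2 * k + 1 →
      ∃ Y B : Fin k → ι → K, ∀ p q, S p q = ∑ t, (Y t p * B t q - B t p * Y t q) := by
  induction k with
  | zero =>
    intro S s h1 h2 h3 h4
    refine ⟨fun _ _ => 0, fun _ _ => 0, fun p q => ?_⟩
    simp only [Finset.univ_eq_empty, Finset.sum_empty]
    by_cases hp : p ∈ s
    · by_cases hq : q ∈ s
      · have : p = q := Finset.card_le_one.1 (by omega) p hp q hq
        rw [this, h2]
      · rw [h1, h3 q p hq, neg_zero]
    · exact h3 p q hp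
  | succ k ih =>
    intro S s h1 h2 h3 h4
    by_cases h0 : ∀ p q, S p q = 0
    · exact ⟨fun _ _ => 0, fun _ _ => 0, fun p q => by simp [h0]⟩
    · push Not at h0
      obtain ⟨i, j, hij⟩ := h0
      have hne : i ≠ j := by rintro rfl; exact hij (h2 i)
      have his : i ∈ s := by by_contra h; exact hij (h3 i j h)
      have hjs : j ∈ s := by
        by_contra h; exact hij (by rw [h1, h3 j i h, neg_zero])
      obtain ⟨Y, B, hYB⟩ := ih
        (fun p q => S p q - ((S i j)⁻¹ * S p i * S q j - S p j * ((S i j)⁻¹ * S q i)))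
        ((s.erase i).erase j)
        (fun p q => by rw [h1 p q]; ring) (fun p => by simp only [h2]; ring)
        (fun p q hp => by
          by_cases hpj : p = j
          · subst hpj
            simp only [h2]
            rw [h1 p i, h1 q p]; field_simp; ring
          by_cases hpi : p = i
          · subst hpi
            simp only [h2]
            rw [h1 q p]; field_simp; ring
          have hps : p ∉ s := fun h => hp (by simp [hpj, hpi, h])
          simp only [h3 p _ hps]; ring)
        (by
          rw [Finset.card_erase_of_mem (by simp [hjs, hne.symm]), Finset.card_erase_of_mem his]
          omega)
      refine ⟨Fin.cons (fun p => (S i j)⁻¹ * S p i) Y, Fin.cons (fun p => S p j) B, fun p q => ?_⟩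
      rw [Fin.sum_univ_succ]
      simp only [Fin.cons_zero, Fin.cons_succ, ← hYB]
      ring

abbrev NN (k : ℕ) := Fin (k+1) ⊕ Fin k

/-- general alternating sum -/
def FF {R : Type*} [CommRing R] {k : ℕ} (a : NN k → R) (C : Fin k → NN k → NN k → R) : R :=
  ∑ σ : Equiv.Perm (NN k), ((Equiv.Perm.sign σ : ℤ) : R) *
    (a (σ (Sum.inl 0)) * ∏ t : Fin k, C t (σ (Sum.inl t.succ)) (σ (Sum.inr t)))

theorem FF_sym_zero {R : Type*} [CommRing R] {k : ℕ} (a : NN k → R)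
    (C : Fin k → NN k → NN k → R) (t : Fin k) (h : ∀ p q, C t p q = C t q p) : FF a C = 0 := by
  unfold FF
  have hne : (Sum.inl t.succ : NN k) ≠ Sum.inr t := by simp
  refine Finset.sum_involution (fun σ _ => σ * Equiv.swap (Sum.inl t.succ) (Sum.inr t)) ?_ ?_ ?_ ?_
  · intro σ _
    have h0 : (σ * Equiv.swap (Sum.inl t.succ) (Sum.inr t)) (Sum.inl 0) = σ (Sum.inl 0) := by
      rw [Equiv.Perm.mul_apply, Equiv.swap_apply_of_ne_of_ne]
      · intro h; exact absurd (Sum.inl.inj h) (Fin.succ_ne_zero t).symm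
      · simp
    have hp : ∏ u : Fin k, C u ((σ * Equiv.swap (Sum.inl t.succ) (Sum.inr t)) (Sum.inl u.succ))
        ((σ * Equiv.swap (Sum.inl t.succ) (Sum.inr t)) (Sum.inr u)) =
        ∏ u : Fin k, C u (σ (Sum.inl u.succ)) (σ (Sum.inr u)) := by
      refine Finset.prod_congr rfl fun u _ => ?_
      by_cases hu : u = t
      · subst hu
        simp only [Equiv.Perm.mul_apply, Equiv.swap_apply_left, Equiv.swap_apply_right]
        exact h _ _
      · simp only [Equiv.Perm.mul_apply]
        rw [Equiv.swap_apply_of_ne_of_ne (by simpa using hu) (by simp),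
          Equiv.swap_apply_of_ne_of_ne (by simp) (by simpa using hu)]
    rw [h0, hp, Equiv.Perm.sign_mul, Equiv.Perm.sign_swap hne]
    push_cast
    ring
  · intro σ _ _ h
    have := mul_eq_left.1 h
    exact hne (Equiv.swap_eq_one_iff.1 this)
  · simp
  · intro σ _
    simp [mul_assoc]

theorem FF_congr {R : Type*} [CommRing R] {k : ℕ} (a : NN k → R)
    (C D : NN k → NN k → R) (h : ∀ p q, C p q - C q p = D p q - D q p) :
    FF a (fun _ => C) = FF a (fun _ => D) := by
  have key : ∀ s : Finset (Fin k), FF a (fun t => if t ∈ s then C else D) = FF a (fun _ => D) := by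
    intro s
    induction s using Finset.induction_on with
    | empty => simp
    | insert t s ht ih =>
      rw [← ih, ← sub_eq_zero]
      rw [← FF_sym_zero a (fun u => if u = t then (fun p q => C p q - D p q) else
        if u ∈ s then C else D) t (by intro p q; simp only [if_true]; linear_combination h p q)]
      unfold FF
      rw [← Finset.sum_sub_distrib]
      refine Finset.sum_congr rfl fun σ _ => ?_
      rw [← mul_sub, ← mul_sub]
      congr 2
      simp only [← Finset.mul_prod_erase _ _ (Finset.mem_univ t)]
      have e1 : ∏ x ∈ Finset.univ.erase t, (if x ∈ insert t s then C else D)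
          (σ (Sum.inl x.succ)) (σ (Sum.inr x)) = ∏ x ∈ Finset.univ.erase t, (if x ∈ s then C else D)
          (σ (Sum.inl x.succ)) (σ (Sum.inr x)) := by
        refine Finset.prod_congr rfl fun x hx => ?_
        simp [Finset.ne_of_mem_erase hx]
      have e2 : ∏ x ∈ Finset.univ.erase t, (if x = t then (fun p q => C p q - D p q) else
        if x ∈ s then C else D)
          (σ (Sum.inl x.succ)) (σ (Sum.inr x)) = ∏ x ∈ Finset.univ.erase t, (if x ∈ s then C else D)
          (σ (Sum.inl x.succ)) (σ (Sum.inr x)) := by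
        refine Finset.prod_congr rfl fun x hx => ?_
        simp [Finset.ne_of_mem_erase hx]
      rw [e1, e2]
      simp [ht, sub_mul]
  simpa using key Finset.univ

theorem sum_incr {R : Type*} [CommRing R] {r n : ℕ} (φ : (Fin r → Fin n) → R)
    (h1 : ∀ (f) (τ : Equiv.Perm (Fin r)), φ (f ∘ τ) = φ f)
    (h2 : ∀ f, ¬ Function.Injective f → φ f = 0) :
    ∑ f, φ f = (r.factorial : R) * ∑ f ∈ incrFuns r n, φ f := by
  have e : ∑ f, φ f = ∑ f ∈ Finset.univ.filter (fun f : Fin r → Fin n => Function.Injective f), φ f := by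
    rw [Finset.sum_filter]
    refine Finset.sum_congr rfl fun f _ => ?_
    split_ifs with h
    · rfl
    · exact h2 f h
  have hs : ∀ f ∈ incrFuns r n, StrictMono f := by
    intro f hf a b hab
    exact (Finset.mem_filter.1 hf).2 a b hab
  have e2 : ∑ p ∈ incrFuns r n ×ˢ (Finset.univ : Finset (Equiv.Perm (Fin r))), φ (p.1) =
    ∑ f ∈ Finset.univ.filter (fun f : Fin r → Fin n => Function.Injective f), φ f := by
    refine Finset.sum_bij (fun p _ => p.1 ∘ p.2) ?_ ?_ ?_ ?_
    · rintro ⟨f, τ⟩ hp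
      simp only [Finset.mem_product, Finset.mem_univ, and_true] at hp
      simp only [Finset.mem_filter, Finset.mem_univ, true_and]
      exact (hs f hp).injective.comp τ.injective
    · rintro ⟨f, τ⟩ hp ⟨g, υ⟩ hq h
      simp only [Finset.mem_product, Finset.mem_univ, and_true] at hp hq h
      have hr : Set.range f = Set.range g := by
        rw [← τ.surjective.range_comp f, h, υ.surjective.range_comp g]
      have hfg : f = g := (StrictMono.range_inj (hs f hp) (hs g hq)).1 hr
      subst hfg
      congr 1
      ext x
      exact congrArg Fin.val ((hs f hp).injective (congrFun h x))
    · intro f hf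
      simp only [Finset.mem_filter, Finset.mem_univ, true_and] at hf
      refine ⟨(f ∘ Tuple.sort f, (Tuple.sort f)⁻¹), ?_, ?_⟩
      · simp only [Finset.mem_product, Finset.mem_univ, and_true, incrFuns, Finset.mem_filter, true_and]
        exact (Tuple.monotone_sort f).strictMono_of_injective (hf.comp (Tuple.sort f).injective)
      · ext x; simp
    · rintro ⟨f, τ⟩ _
      exact (h1 f τ).symm
  rw [e, ← e2, Finset.sum_product, Finset.mul_sum]
  refine Finset.sum_congr rfl fun f _ => ?_
  simp [Fintype.card_perm]

def eqv (k : ℕ) : NN k ≃ Fin (2*k+1) := finSumFinEquiv.trans (finCongr (by omega))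

def DD {R : Type*} [CommRing R] {k n : ℕ} (A B : NN k → Fin n → R)
    (f : Fin (k+1) → Fin n) (j : Fin k → Fin n) : R :=
  Matrix.det (Matrix.of fun (p c : NN k) => Sum.elim (fun i => A p (f i)) (fun t => B p (j t)) c)

theorem concat_det {R : Type*} [CommRing R] {k n : ℕ} (A B : Matrix (Fin (2*k+1)) (Fin n) R)
    (f : Fin (k+1) → Fin n) (j : Fin k → Fin n) :
    (concatCBodd A B f j).det = DD (fun p => A (eqv k p)) (fun p => B (eqv k p)) f j := by
  rw [← Matrix.det_submatrix_equiv_self (eqv k)]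
  unfold DD
  congr 1
  ext p c
  rcases c with i | t
  · simp [concatCBodd, eqv]
    intro h
    have := i.isLt
    omega
  · simp [concatCBodd, eqv]
    intro h
    omega

def HH {R : Type*} [CommRing R] {k n : ℕ} (a : NN k → R) (Y B : NN k → Fin n → R)
    (j : Fin k → Fin n) : R :=
  Matrix.det (Matrix.of fun (p c : NN k) =>
    Sum.elim (Fin.cons (a p) (fun t => Y p (j t)) : Fin (k+1) → R) (fun t => B p (j t)) c)

theorem HH_perm {R : Type*} [CommRing R] {k n : ℕ} (a : NN k → R) (Y B : NN k → Fin n → R)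
    (j : Fin k → Fin n) (τ : Equiv.Perm (Fin k)) : HH a Y B (j ∘ τ) = HH a Y B j := by
  unfold HH
  have := Matrix.det_permute' (Equiv.Perm.sumCongr (Equiv.Perm.decomposeFin.symm (0, τ)) τ)
    (Matrix.of fun (p c : NN k) =>
    Sum.elim (Fin.cons (a p) (fun t => Y p (j t)) : Fin (k+1) → R) (fun t => B p (j t)) c)
  rw [Equiv.Perm.sign_sumCongr, Equiv.Perm.decomposeFin.symm_sign, if_pos rfl, one_mul,
    Int.units_mul_self] at this
  simp only [Units.val_one, Int.cast_one, one_mul] at this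
  rw [← this]
  congr 1
  ext p c
  rcases c with i | t
  · refine Fin.cases ?_ (fun i => ?_) i
    · simp
    · simp
  · simp

theorem HH_inj {R : Type*} [CommRing R] {k n : ℕ} (a : NN k → R) (Y B : NN k → Fin n → R)
    (j : Fin k → Fin n) (h : ¬ Function.Injective j) : HH a Y B j = 0 := by
  unfold Function.Injective at h
  push Not at h
  obtain ⟨s, t, hst, hne⟩ := h
  refine Matrix.det_zero_of_column_eq (i := Sum.inr s) (j := Sum.inr t) (by simpa using hne) ?_
  intro p
  simp [hst]

theorem HH_sum {R : Type*} [CommRing R] {k n : ℕ} (a : NN k → R) (Y B : NN k → Fin n → R) :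
    ∑ j, HH a Y B j = FF a (fun _ p q => ∑ l, Y p l * B q l) := by
  unfold HH FF
  simp only [Matrix.det_apply']
  rw [Finset.sum_comm]
  refine Finset.sum_congr rfl fun σ _ => ?_
  rw [← Finset.mul_sum]
  congr 1
  rw [Finset.prod_univ_sum, Finset.mul_sum, Fintype.piFinset_univ]
  refine Finset.sum_congr rfl fun j _ => ?_
  simp [Fintype.prod_sum_type, Fin.prod_univ_succ, Finset.prod_mul_distrib, mul_assoc]

theorem HH_incr {R : Type*} [CommRing R] {k n : ℕ} (a : NN k → R) (Y B : NN k → Fin n → R) :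
    (k.factorial : R) * ∑ j ∈ incrFuns k n, HH a Y B j
      = FF a (fun _ p q => ∑ l, Y p l * B q l) := by
  rw [← HH_sum, sum_incr _ (fun f τ => HH_perm a Y B f τ) (fun f => HH_inj a Y B f)]

theorem incr_self (k : ℕ) : incrFuns k k = {id} := by
  ext f
  simp only [incrFuns, Finset.mem_filter, Finset.mem_univ, true_and, Finset.mem_singleton]
  constructor
  · intro h
    have hs : StrictMono f := fun a b hab => h a b hab
    have : Set.range f = Set.range (id : Fin k → Fin k) := by
      rw [(Finite.injective_iff_surjective.1 hs.injective).range_eq, Set.range_id]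
    exact (StrictMono.range_inj hs strictMono_id).1 this
  · rintro rfl a b h
    exact h

theorem HH_id {R : Type*} [CommRing R] {k : ℕ} (a : NN k → R) (Y B : NN k → Fin k → R) :
    (k.factorial : R) * HH a Y B id
      = FF a (fun _ p q => ∑ l, Y p l * B q l) := by
  rw [← HH_incr, incr_self, Finset.sum_singleton]

theorem DD_perm {R : Type*} [CommRing R] {k n : ℕ} (A B : NN k → Fin n → R)
    (f : Fin (k+1) → Fin n) (j : Fin k → Fin n) (τ : Equiv.Perm (Fin (k+1))) :
    DD A B (f ∘ τ) j = ((Equiv.Perm.sign τ : ℤ) : R) * DD A B f j := by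
  unfold DD
  have := Matrix.det_permute' (Equiv.Perm.sumCongr τ (1 : Equiv.Perm (Fin k)))
    (Matrix.of fun (p c : NN k) => Sum.elim (fun i => A p (f i)) (fun t => B p (j t)) c)
  rw [Equiv.Perm.sign_sumCongr, Equiv.Perm.sign_one, mul_one] at this
  rw [← this]
  congr 1
  ext p c
  rcases c with i | t
  · simp
  · simp

theorem DD_inj {R : Type*} [CommRing R] {k n : ℕ} (A B : NN k → Fin n → R)
    (f : Fin (k+1) → Fin n) (j : Fin k → Fin n) (h : ¬ Function.Injective f) : DD A B f j = 0 := by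
  unfold Function.Injective at h
  push Not at h
  obtain ⟨s, t, hst, hne⟩ := h
  refine Matrix.det_zero_of_column_eq (i := Sum.inl s) (j := Sum.inl t) (by simpa using hne) ?_
  intro p
  simp [hst]

theorem sgn_sq {R : Type*} [CommRing R] {α : Type*} [Fintype α] [DecidableEq α]
    (τ : Equiv.Perm α) :
    ((Equiv.Perm.sign τ : ℤ) : R) * ((Equiv.Perm.sign τ : ℤ) : R) = 1 := by
  rw [← Int.cast_mul, ← Units.val_mul, Int.units_mul_self]; simp

theorem oneCol_eq {R : Type*} [CommRing R] {k n : ℕ} (X : Matrix (Fin n) (Fin n) R)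
    (f : Fin (k+1) → Fin n) (j : Fin k → Fin n) :
    oneCol X f j = Matrix.of fun i c => (Fin.cons 1 (fun t => X (f i) (j t)) : Fin (k+1) → R) c := by
  ext i c
  refine Fin.cases ?_ (fun c => ?_) c <;> simp [oneCol]

theorem oneCol_perm {R : Type*} [CommRing R] {k n : ℕ} (X : Matrix (Fin n) (Fin n) R)
    (f : Fin (k+1) → Fin n) (j : Fin k → Fin n) (τ : Equiv.Perm (Fin (k+1))) :
    (oneCol X (f ∘ τ) j).det = ((Equiv.Perm.sign τ : ℤ) : R) * (oneCol X f j).det := by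
  rw [← Matrix.det_permute]
  rfl

theorem sum_f {R : Type*} [CommRing R] {k n : ℕ} (A B : NN k → Fin n → R)
    (X : Matrix (Fin n) (Fin n) R) (j : Fin k → Fin n) :
    ∑ f, (oneCol X f j).det * DD A B f j =
      ((k+1).factorial : R) * HH (fun p => ∑ l, A p l) (fun p q => ∑ l, A p l * X l q) B j := by
  have e1 : ∑ f, (oneCol X f j).det * DD A B f j =
      ∑ τ : Equiv.Perm (Fin (k+1)), ∑ f : Fin (k+1) → Fin n,
        (∏ i, (Fin.cons 1 (fun t => X (f i) (j t)) : Fin (k+1) → R) i) * DD A B f j := by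
    simp only [Matrix.det_apply', Finset.sum_mul]
    rw [Finset.sum_comm]
    refine Finset.sum_congr rfl fun τ _ => ?_
    refine Fintype.sum_equiv (Equiv.arrowCongr τ⁻¹ (Equiv.refl _)) _ _ fun f => ?_
    have : (Equiv.arrowCongr τ⁻¹ (Equiv.refl _)) f = f ∘ τ := by
      rfl
    rw [this, DD_perm, oneCol_eq]
    simp only [Matrix.of_apply, Function.comp]
    ring
  rw [e1, Finset.sum_const, Finset.card_univ, Fintype.card_perm, Fintype.card_fin, nsmul_eq_mul]
  congr 1
  unfold HH DD
  simp only [Matrix.det_apply', Finset.mul_sum]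
  rw [Finset.sum_comm]
  refine Finset.sum_congr rfl fun σ _ => ?_
  have e2 : ∀ i : Fin (k+1), (Fin.cons (∑ l, A (σ (Sum.inl i)) l)
      (fun t => ∑ l, A (σ (Sum.inl i)) l * X l (j t)) : Fin (k+1) → R) i
      = ∑ l, (Fin.cons 1 (fun t => X l (j t)) : Fin (k+1) → R) i * A (σ (Sum.inl i)) l := by
    intro i
    refine Fin.cases ?_ (fun i => ?_) i
    · simp
    · simp [mul_comm]
  simp only [Fintype.prod_sum_type, Matrix.of_apply, Sum.elim_inl, Sum.elim_inr, e2]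
  rw [Finset.prod_univ_sum, Fintype.piFinset_univ, Finset.sum_mul, Finset.mul_sum]
  refine Finset.sum_congr rfl fun f _ => ?_
  rw [Finset.prod_mul_distrib]
  ring

theorem gAB_F {K : Type*} [Field K] [CharZero K] {k n : ℕ} (A B : Matrix (Fin (2*k+1)) (Fin n) K)
    (X : Matrix (Fin n) (Fin n) K) :
    (k.factorial : K) * gAB A B X =
      FF (fun p => ∑ l, A (eqv k p) l) (fun _ p q => (A * X * Bᵀ) (eqv k p) (eqv k q)) := by
  have h := HH_incr (fun p => ∑ l, A (eqv k p) l) (fun p q => ∑ l, A (eqv k p) l * X l q)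
    (fun p => B (eqv k p))
  have e : (fun (_ : Fin k) (p q : NN k) => (A * X * Bᵀ) (eqv k p) (eqv k q)) =
      fun _ p q => ∑ l, (∑ l', A (eqv k p) l' * X l' l) * B (eqv k q) l := by
    ext _ p q
    simp [Matrix.mul_apply]
  rw [e, ← h]
  congr 1
  unfold gAB
  rw [Finset.sum_comm]
  refine Finset.sum_congr rfl fun j _ => ?_
  have hf : ((k+1).factorial : K) ≠ 0 := by exact_mod_cast (k+1).factorial_ne_zero
  apply mul_left_cancel₀ hf
  rw [← sum_f, sum_incr]
  · simp only [concat_det]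
  · intro f τ
    rw [oneCol_perm, DD_perm]
    linear_combination (oneCol X f j).det * DD (fun p => A (eqv k p)) (fun p => B (eqv k p)) f j *
      sgn_sq (R := K) τ
  · intro f hf
    rw [DD_inj _ _ _ _ hf, mul_zero]

theorem gAB_ones {R : Type*} [CommRing R] {k n : ℕ} (A B : Matrix (Fin (2*k+1)) (Fin n) R)
    (X : Matrix (Fin n) (Fin n) R) :
    gAB A B (allOnes R n - X) = gAB A B (-X) := by
  unfold gAB
  refine Finset.sum_congr rfl fun f _ => Finset.sum_congr rfl fun j _ => ?_
  congr 1
  rw [← Matrix.det_transpose, ← Matrix.det_transpose (oneCol (-X) f j)]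
  refine Matrix.det_eq_of_forall_row_eq_smul_add_const (fun c => if c = 0 then 0 else 1) 0 (by simp) ?_
  intro c i
  rw [oneCol_eq, oneCol_eq]
  refine Fin.cases ?_ (fun c => ?_) c
  · simp
  · simp [allOnes]; ring

theorem gAB_neg {R : Type*} [CommRing R] {k n : ℕ} (A B : Matrix (Fin (2*k+1)) (Fin n) R)
    (X : Matrix (Fin n) (Fin n) R) :
    gAB A B (-X) = (-1)^k * gAB A B X := by
  unfold gAB
  simp only [Finset.mul_sum]
  refine Finset.sum_congr rfl fun f _ => Finset.sum_congr rfl fun j _ => ?_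
  rw [← mul_assoc]
  congr 1
  have := Matrix.det_mul_row (Fin.cons 1 (fun _ => -1) : Fin (k+1) → R) (oneCol X f j)
  rw [Fin.prod_univ_succ] at this
  simp only [Fin.cons_zero, Fin.cons_succ, Finset.prod_const, Finset.card_univ, Fintype.card_fin,
    one_mul] at this
  rw [← this]
  congr 1
  rw [oneCol_eq, oneCol_eq]
  ext i c
  refine Fin.cases ?_ (fun c => ?_) c <;> simp

theorem main_field {K : Type*} [Field K] [CharZero K] (k n : ℕ)
    (A B : Matrix (Fin (2*k+1)) (Fin n) K) (X : Matrix (Fin n) (Fin n) K) :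
    (A * X * Bᵀ + B * (allOnes K n - Xᵀ) * Aᵀ).det = gAB A B X * gAB B A (-Xᵀ) := by
  set C : NN k → NN k → K := fun p q => (A * X * Bᵀ) (eqv k p) (eqv k q) with hC
  set a : NN k → K := fun p => ∑ l, A (eqv k p) l with ha
  set b : NN k → K := fun p => ∑ l, B (eqv k p) l with hb
  have hCt : ∀ p q, (B * (-Xᵀ) * Aᵀ) (eqv k p) (eqv k q) = - C q p := by
    intro p q
    have : B * (-Xᵀ) * Aᵀ = - (A * X * Bᵀ)ᵀ := by
      simp [Matrix.transpose_mul, Matrix.mul_assoc]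
    rw [this]; rfl
  obtain ⟨Y, D, hYD⟩ := aux_normal k (fun p q => C p q - C q p) Finset.univ
    (fun p q => by ring) (fun p => by ring) (by simp) (by simp; omega)
  have f1 : (k.factorial : K) * gAB A B X =
      (k.factorial : K) * HH a (fun p t => D t p) (fun p t => - Y t p) id := by
    rw [gAB_F, HH_id]
    apply FF_congr
    intro p q
    rw [hYD p q, ← Finset.sum_sub_distrib]
    exact Finset.sum_congr rfl fun t _ => by ring
  have f2 : (k.factorial : K) * gAB B A (-Xᵀ) =
      (k.factorial : K) * HH b (fun p t => Y t p) (fun p t => D t p) id := by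
    rw [gAB_F, HH_id]
    apply FF_congr
    intro p q
    rw [hCt, hCt, ← Finset.sum_sub_distrib]
    have := hYD p q
    beta_reduce at this
    rw [show - C q p - - C p q = C p q - C q p by ring, this]
    exact Finset.sum_congr rfl fun t _ => by ring
  have hf : (k.factorial : K) ≠ 0 := by exact_mod_cast k.factorial_ne_zero
  rw [mul_left_cancel₀ hf f1, mul_left_cancel₀ hf f2,
    mul_comm (HH a _ _ _)]
  unfold HH
  rw [← Matrix.det_transpose (Matrix.of fun (p c : NN k) =>
    Sum.elim (Fin.cons (a p) _ : Fin (k+1) → K) _ c), ← Matrix.det_mul,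
    ← Matrix.det_submatrix_equiv_self (eqv k)]
  congr 1
  ext p q
  have e1 : (B * allOnes K n * Aᵀ) (eqv k p) (eqv k q) = b p * a q := by
    simp [Matrix.mul_apply, allOnes, ha, hb, Finset.mul_sum]
  have e2 : B * (allOnes K n - Xᵀ) * Aᵀ = B * allOnes K n * Aᵀ + B * (-Xᵀ) * Aᵀ := by
    rw [sub_eq_add_neg, Matrix.mul_add, Matrix.add_mul]
  rw [e2, Matrix.submatrix_apply, Matrix.add_apply, Matrix.add_apply, e1, hCt]
  have := hYD p q
  simp only [Finset.sum_sub_distrib] at this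
  change C p q + _ = _
  simp only [Matrix.mul_apply, Fintype.sum_sum_type, Fin.sum_univ_succ, Matrix.of_apply,
    Matrix.transpose_apply, Sum.elim_inl, Sum.elim_inr, Fin.cons_zero, Fin.cons_succ, id,
    mul_neg, Finset.sum_neg_distrib]
  linear_combination this

theorem gAB_map {R T : Type*} [CommRing R] [CommRing T] (φ : R →+* T) {k n : ℕ}
    (A B : Matrix (Fin (2*k+1)) (Fin n) R) (X : Matrix (Fin n) (Fin n) R) :
    φ (gAB A B X) = gAB (A.map φ) (B.map φ) (X.map φ) := by
  unfold gAB
  simp only [map_sum, map_mul, RingHom.map_det]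
  refine Finset.sum_congr rfl fun f _ => Finset.sum_congr rfl fun j _ => ?_
  congr 2
  · ext i c
    simp only [oneCol, RingHom.mapMatrix_apply, Matrix.map_apply, Matrix.of_apply]
    split_ifs <;> simp
  · ext i c
    simp only [concatCBodd, RingHom.mapMatrix_apply, Matrix.map_apply, Matrix.of_apply]
    split_ifs <;> simp

theorem lhs_map {R T : Type*} [CommRing R] [CommRing T] (φ : R →+* T) {k n : ℕ}
    (A B : Matrix (Fin (2*k+1)) (Fin n) R) (X : Matrix (Fin n) (Fin n) R) :
    φ ((A * X * Bᵀ + B * (allOnes R n - Xᵀ) * Aᵀ).det) =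
      ((A.map φ) * (X.map φ) * (B.map φ)ᵀ +
        (B.map φ) * (allOnes T n - (X.map φ)ᵀ) * (A.map φ)ᵀ).det := by
  rw [RingHom.map_det]
  congr 1
  ext i j
  simp [Matrix.mul_apply, allOnes]

theorem neg_map_aux {R T : Type*} [CommRing R] [CommRing T] (φ : R →+* T) {n : ℕ}
    (X : Matrix (Fin n) (Fin n) R) : (-Xᵀ).map φ = -(X.map φ)ᵀ := by
  ext i j; simp

theorem main_ring {R : Type*} [CommRing R] (k n : ℕ)
    (A B : Matrix (Fin (2*k+1)) (Fin n) R) (X : Matrix (Fin n) (Fin n) R) :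
    (A * X * Bᵀ + B * (allOnes R n - Xᵀ) * Aᵀ).det = gAB A B X * gAB B A (-Xᵀ) := by
  let V := (Fin (2*k+1) × Fin n) ⊕ (Fin (2*k+1) × Fin n) ⊕ (Fin n × Fin n)
  let P := MvPolynomial V ℤ
  let A' : Matrix (Fin (2*k+1)) (Fin n) P := Matrix.of fun i j => MvPolynomial.X (Sum.inl (i, j))
  let B' : Matrix (Fin (2*k+1)) (Fin n) P :=
    Matrix.of fun i j => MvPolynomial.X (Sum.inr (Sum.inl (i, j)))
  let X' : Matrix (Fin n) (Fin n) P :=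
    Matrix.of fun i j => MvPolynomial.X (Sum.inr (Sum.inr (i, j)))
  haveI : CharZero (FractionRing P) :=
    charZero_of_injective_algebraMap (IsFractionRing.injective P (FractionRing P))
  have hP : (A' * X' * B'ᵀ + B' * (allOnes P n - X'ᵀ) * A'ᵀ).det
      = gAB A' B' X' * gAB B' A' (-X'ᵀ) := by
    apply IsFractionRing.injective P (FractionRing P)
    rw [map_mul, lhs_map, gAB_map, gAB_map, neg_map_aux, main_field]
  let φ : P →+* R := MvPolynomial.eval₂Hom (Int.castRingHom R)
    (Sum.elim (fun x => A x.1 x.2) (Sum.elim (fun x => B x.1 x.2) (fun x => X x.1 x.2)))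
  have h := congrArg φ hP
  have hA : A'.map φ = A := by ext i j; exact MvPolynomial.eval₂Hom_X' _ _ _
  have hB : B'.map φ = B := by ext i j; exact MvPolynomial.eval₂Hom_X' _ _ _
  have hX : X'.map φ = X := by ext i j; exact MvPolynomial.eval₂Hom_X' _ _ _
  rw [map_mul, lhs_map, gAB_map, gAB_map, neg_map_aux, hA, hB, hX] at h
  exact h

end helpers

/-- Theorem (main theorem, odd case): for `m = 2k+1` odd,
`det(A·X·Bᵗ + B·(𝒥 − Xᵗ)·Aᵗ) = g_{A,B}(X)·g_{B,A}(𝒥 − Xᵗ)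
= (−1)^{(m−1)/2}·g_{A,B}(X)·g_{B,A}(Xᵗ)`. -/
theorem det_eq_gAB_mul_gBA_odd {R : Type*} [CommRing R] (k n : ℕ) (hn : 0 < n)
    (A B : Matrix (Fin (2*k+1)) (Fin n) R) (X : Matrix (Fin n) (Fin n) R) :
    (A * X * Bᵀ + B * (allOnes R n - Xᵀ) * Aᵀ).det
        = gAB A B X * gAB B A (allOnes R n - Xᵀ) ∧
      (A * X * Bᵀ + B * (allOnes R n - Xᵀ) * Aᵀ).det
        = (-1 : R)^k * (gAB A B X * gAB B A Xᵀ) := by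
  rw [gAB_ones, main_ring]
  refine ⟨rfl, ?_⟩
  rw [gAB_neg]
  ring
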